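/- Let α > 0 and a, b ∈ ℝ³, and set R := ‖a − b‖. Then the two-center exchange integral satisfies (α³/π)·∫_{ℝ³} e^{−α(‖x−a‖ + ‖x−b‖)}/‖x−b‖ dx = α·e^{−αR}·(1 + αR). -/

import Mathlib

open MeasureTheory Set Filter Topology

noncomputable def hlH (α R z s : ℝ) : ℝ :=
  Real.exp (-α * (√((z-R)^2+s) + √(z^2+s))) * (1/√((z-R)^2+s) + 1/√(z^2+s))

lemma hl_radial (α R z : ℝ) (hα : 0 < α) :
    ∫⁻ r in Ioi (0:ℝ), ENNReal.ofReal (r * hlH α R z (r^2))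
      = ENNReal.ofReal (Real.exp (-α * (|z-R| + |z|)) / α) := by
  have hd : ∀ r ∈ Ioi (0:ℝ), HasDerivAt
      (fun r : ℝ => - (Real.exp (-α * (√((z-R)^2+r^2) + √(z^2+r^2))) / α))
      (r * hlH α R z (r^2)) r := by
    intro r hr
    have hr : 0 < r := hr
    have h1 : ∀ w : ℝ, HasDerivAt (fun r : ℝ => √(w^2+r^2)) (r / √(w^2+r^2)) r := by
      intro w
      have hp : 0 < w^2 + r^2 := by positivity
      have := (((hasDerivAt_pow 2 r).const_add (w^2))).sqrt hp.ne'
      convert this using 1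
      field_simp
      norm_num [mul_comm]
    have := ((((h1 (z-R)).add (h1 z)).const_mul (-α)).exp.div_const α).neg
    refine HasDerivAt.congr_deriv this ?_
    unfold hlH
    simp only [Pi.add_apply]
    field_simp
  have hc : ContinuousWithinAt
      (fun r : ℝ => - (Real.exp (-α * (√((z-R)^2+r^2) + √(z^2+r^2))) / α)) (Ici 0) 0 := by
    apply Continuous.continuousWithinAt
    fun_prop
  have hpos : ∀ r ∈ Ioi (0:ℝ), 0 ≤ r * hlH α R z (r^2) := by
    intro r hr
    have hr : 0 < r := hr
    unfold hlH
    positivity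
  have ht : Tendsto (fun r : ℝ => - (Real.exp (-α * (√((z-R)^2+r^2) + √(z^2+r^2))) / α))
      atTop (𝓝 0) := by
    have h0 : Tendsto (fun r : ℝ => √((z-R)^2+r^2) + √(z^2+r^2)) atTop atTop := by
      refine tendsto_atTop_mono (fun r => ?_) tendsto_id
      have : r ≤ √(z^2+r^2) := Real.le_sqrt_of_sq_le (by nlinarith [sq_nonneg z])
      have := Real.sqrt_nonneg ((z-R)^2+r^2)
      simp only [id]; linarith
    have h1 := Real.tendsto_exp_atBot.comp (h0.const_mul_atTop_of_neg (neg_lt_zero.mpr hα))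
    simpa using (h1.div_const α).neg
  rw [← ofReal_integral_eq_lintegral_ofReal
    (integrableOn_Ioi_deriv_of_nonneg hc hd hpos ht)
    ((ae_restrict_iff' measurableSet_Ioi).2 (Eventually.of_forall hpos)),
    integral_Ioi_of_hasDerivAt_of_nonneg hc hd hpos ht]
  congr 1
  simp [Real.sqrt_sq_eq_abs]

lemma hlH_meas (α R z : ℝ) : Measurable (hlH α R z) := by
  unfold hlH; fun_prop

lemma hl_plane (α R z : ℝ) (hα : 0 < α) :
    ∫⁻ p : ℝ × ℝ, ENNReal.ofReal (hlH α R z (p.1^2 + p.2^2))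
      = ENNReal.ofReal (2 * Real.pi / α * Real.exp (-α * (|z-R| + |z|))) := by
  have hm := hlH_meas α R z
  rw [← lintegral_comp_polarCoord_symm]
  have e : ∀ p : ℝ × ℝ, ENNReal.ofReal p.1 • ENNReal.ofReal
      (hlH α R z ((polarCoord.symm p).1^2 + (polarCoord.symm p).2^2))
      = ENNReal.ofReal p.1 * ENNReal.ofReal (hlH α R z (p.1^2)) := by
    intro p
    simp only [polarCoord_symm_apply, smul_eq_mul]
    congr 3
    nlinarith [Real.sin_sq_add_cos_sq p.2]
  simp_rw [e]
  rw [polarCoord_target, Measure.volume_eq_prod, ← Measure.prod_restrict,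
    lintegral_prod _ (by fun_prop)]
  simp only [lintegral_const, Measure.restrict_apply_univ, Real.volume_Ioo]
  rw [lintegral_mul_const _ (by fun_prop)]
  have : ∫⁻ r in Ioi (0:ℝ), ENNReal.ofReal r * ENNReal.ofReal (hlH α R z (r^2))
      = ∫⁻ r in Ioi (0:ℝ), ENNReal.ofReal (r * hlH α R z (r^2)) := by
    refine setLIntegral_congr_fun measurableSet_Ioi fun r hr => ?_
    exact (ENNReal.ofReal_mul (le_of_lt hr)).symm
  rw [this, hl_radial α R z hα, ← ENNReal.ofReal_mul (by positivity)]
  congr 1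
  ring

lemma hl_line (α R : ℝ) (hα : 0 < α) (hR : 0 ≤ R) :
    ∫⁻ z : ℝ, ENNReal.ofReal (2 * Real.pi / α * Real.exp (-α * (|z-R| + |z|)))
      = ENNReal.ofReal (2 * Real.pi / α * (Real.exp (-α * R) * (R + 1/α))) := by
  have hp : 0 ≤ 2 * Real.pi / α := by positivity
  simp_rw [ENNReal.ofReal_mul hp]
  rw [lintegral_const_mul _ (by fun_prop)]
  congr 1
  rw [← lintegral_add_compl _ (measurableSet_Iic (a := (0:ℝ))), compl_Iic,
    ← Ioc_union_Ioi_eq_Ioi hR, lintegral_union measurableSet_Ioi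
      (by rw [Set.disjoint_left]; intro x hx hx'; exact absurd hx.2 (not_le.2 hx'))]
  have h1 : ∫⁻ z in Iic (0:ℝ), ENNReal.ofReal (Real.exp (-α * (|z-R| + |z|)))
      = ENNReal.ofReal (Real.exp (-α * R) * (1/(2*α))) := by
    have := integral_exp_mul_Iic (a := 2*α) (by positivity) 0
    have hi := integrableOn_exp_mul_Iic (a := 2*α) (by positivity) 0
    rw [setLIntegral_congr_fun (g := fun z => ENNReal.ofReal (Real.exp (-α*R) * Real.exp (2*α*z)))
      measurableSet_Iic]
    · rw [← ofReal_integral_eq_lintegral_ofReal (hi.const_mul _)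
        (Eventually.of_forall fun z => by positivity), integral_const_mul, this]
      simp
    · intro z hz
      have hz : z ≤ 0 := hz
      simp only
      rw [← Real.exp_add, abs_of_nonpos hz, abs_of_nonpos (by linarith)]
      congr 2; ring
  have h2 : ∫⁻ z in Ioc (0:ℝ) R, ENNReal.ofReal (Real.exp (-α * (|z-R| + |z|)))
      = ENNReal.ofReal (Real.exp (-α * R) * R) := by
    rw [setLIntegral_congr_fun (g := fun z => ENNReal.ofReal (Real.exp (-α*R)))
      measurableSet_Ioc]
    · simp [ENNReal.ofReal_mul (Real.exp_nonneg _)]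
    · intro z hz
      simp only
      rw [abs_of_pos hz.1, abs_of_nonpos (by linarith [hz.2])]
      congr 2; ring
  have h3 : ∫⁻ z in Ioi R, ENNReal.ofReal (Real.exp (-α * (|z-R| + |z|)))
      = ENNReal.ofReal (Real.exp (-α * R) * (1/(2*α))) := by
    have := integral_exp_mul_Ioi (a := -(2*α)) (by linarith) R
    have hi := integrableOn_exp_mul_Ioi (a := -(2*α)) (by linarith) R
    rw [setLIntegral_congr_fun (g := fun z => ENNReal.ofReal (Real.exp (α*R) * Real.exp (-(2*α)*z)))
      measurableSet_Ioi]
    · rw [← ofReal_integral_eq_lintegral_ofReal (hi.const_mul _)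
        (Eventually.of_forall fun z => by positivity), integral_const_mul, this]
      congr 1
      have : Real.exp (-α * R) = Real.exp (α * R) * Real.exp (-(2*α)*R) := by
        rw [← Real.exp_add]; congr 1; ring
      rw [this]; field_simp
    · intro z hz
      have hz : R < z := hz
      simp only
      rw [← Real.exp_add, abs_of_pos (by linarith : 0 < z), abs_of_pos (by linarith)]
      congr 2; ring
  rw [h1, h2, h3, ← ENNReal.ofReal_add (by positivity) (by positivity),
    ← ENNReal.ofReal_add (by positivity) (by positivity)]
  congr 1
  field_simp; ring

/-- Tonelli in coordinates. -/
lemma hl_coord (f : ℝ → ℝ → ENNReal) (hf : Measurable (Function.uncurry f)) :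
    ∫⁻ x : EuclideanSpace ℝ (Fin 3), f (x 0) ((x 1)^2 + (x 2)^2)
      = ∫⁻ z : ℝ, ∫⁻ p : ℝ × ℝ, f z (p.1^2 + p.2^2) := by
  have hmp := ((MeasurePreserving.id (volume : Measure ℝ)).prod
    (volume_preserving_finTwoArrow ℝ)).comp
    ((volume_preserving_piFinSuccAbove (fun _ : Fin 3 => ℝ) 0).comp
    (PiLp.volume_preserving_ofLp (Fin 3)))
  have hF : Measurable (fun q : ℝ × (ℝ × ℝ) => f q.1 (q.2.1^2 + q.2.2^2)) :=
    hf.comp (f := fun q : ℝ × (ℝ × ℝ) => (q.1, (q.2.1^2 + q.2.2^2))) (by fun_prop)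
  rw [← lintegral_prod _ hF.aemeasurable, ← hmp.lintegral_comp hF]
  rfl

lemma hl_total (α R : ℝ) (hα : 0 < α) (hR : 0 ≤ R) :
    ∫⁻ x : EuclideanSpace ℝ (Fin 3), ENNReal.ofReal (hlH α R (x 0) ((x 1)^2 + (x 2)^2))
      = ENNReal.ofReal (2 * Real.pi / α * (Real.exp (-α * R) * (R + 1/α))) := by
  rw [hl_coord (fun z s => ENNReal.ofReal (hlH α R z s)) (by
    unfold hlH Function.uncurry; fun_prop)]
  simp_rw [hl_plane α R _ hα]
  exact hl_line α R hα hR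

lemma hl_half (α R : ℝ) (hα : 0 < α) (hR : 0 ≤ R) (c : EuclideanSpace ℝ (Fin 3))
    (hc : c = EuclideanSpace.single 0 R) :
    ∫⁻ x : EuclideanSpace ℝ (Fin 3), ENNReal.ofReal (Real.exp (-α * (‖x - c‖ + ‖x‖)) / ‖x‖)
      = ENNReal.ofReal (Real.pi / α * (Real.exp (-α * R) * (R + 1/α))) := by
  set I := ∫⁻ x : EuclideanSpace ℝ (Fin 3),
    ENNReal.ofReal (Real.exp (-α * (‖x - c‖ + ‖x‖)) / ‖x‖) with hI
  have h1 : I = ∫⁻ x : EuclideanSpace ℝ (Fin 3),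
      ENNReal.ofReal (Real.exp (-α * (‖x - c‖ + ‖x‖)) / ‖x - c‖) := by
    rw [hI, ← lintegral_sub_left_eq_self _ c]
    refine lintegral_congr fun x => ?_
    rw [show c - x - c = -x by abel, norm_neg, norm_sub_rev c x, add_comm ‖x‖]
  have h2 : I + I = ENNReal.ofReal (2 * Real.pi / α * (Real.exp (-α * R) * (R + 1/α))) := by
    nth_rewrite 1 [h1]
    rw [hI, ← lintegral_add_left (by fun_prop), ← hl_total α R hα hR]
    refine lintegral_congr fun x => ?_
    rw [← ENNReal.ofReal_add (by positivity) (by positivity)]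
    have e1 : ‖x - c‖ = √((x 0 - R)^2 + ((x 1)^2 + (x 2)^2)) := by
      rw [EuclideanSpace.norm_eq, Fin.sum_univ_three, hc]
      simp [add_assoc]
    have e2 : ‖x‖ = √((x 0)^2 + ((x 1)^2 + (x 2)^2)) := by
      rw [EuclideanSpace.norm_eq, Fin.sum_univ_three]
      simp [add_assoc]
    rw [hlH, ← e1, ← e2]
    congr 1; ring
  have h3 : ENNReal.ofReal (2 * Real.pi / α * (Real.exp (-α * R) * (R + 1/α)))
      = 2 * ENNReal.ofReal (Real.pi / α * (Real.exp (-α * R) * (R + 1/α))) := by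
    rw [show (2:ENNReal) = ENNReal.ofReal 2 by simp, ← ENNReal.ofReal_mul (by norm_num)]
    congr 1; ring
  rw [h3, ← two_mul] at h2
  exact (ENNReal.mul_right_inj (by norm_num) (by norm_num)).1 h2

lemma hl_gen (α : ℝ) (hα : 0 < α) (c : EuclideanSpace ℝ (Fin 3)) :
    ∫⁻ x : EuclideanSpace ℝ (Fin 3), ENNReal.ofReal (Real.exp (-α * (‖x - c‖ + ‖x‖)) / ‖x‖)
      = ENNReal.ofReal (Real.pi / α * (Real.exp (-α * ‖c‖) * (‖c‖ + 1/α))) := by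
  set d : EuclideanSpace ℝ (Fin 3) := EuclideanSpace.single 0 ‖c‖ with hd
  have hn : ‖d‖ = ‖c‖ := by simp [hd]
  rw [← hl_half α ‖c‖ hα (norm_nonneg _) d hd]
  set ψ := (ℝ ∙ (d - c))ᗮ.reflection with hψ
  have hψd : ψ d = c := Submodule.reflection_sub hn
  rw [← ψ.measurePreserving.lintegral_comp (by fun_prop)]
  refine lintegral_congr fun x => ?_
  rw [← hψd, ← map_sub, ψ.norm_map, ψ.norm_map]

/-- Heitler–London exchange integral: with `R = ‖a − b‖`,
`(α³/π)∫ e^{−α(‖x−a‖+‖x−b‖)}/‖x−b‖ dx = α e^{−αR}(1 + αR)`. -/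
theorem heitler_london_exchange (α : ℝ) (hα : 0 < α)
    (a b : EuclideanSpace ℝ (Fin 3)) :
    (α^3 / Real.pi) *
        ∫ x : EuclideanSpace ℝ (Fin 3),
          Real.exp (-α * (‖x - a‖ + ‖x - b‖)) / ‖x - b‖
      = α * Real.exp (-α * ‖a - b‖) * (1 + α * ‖a - b‖) := by
  rw [integral_eq_lintegral_of_nonneg_ae (Eventually.of_forall fun x => by positivity)
    (Measurable.aestronglyMeasurable (by fun_prop))]
  have := hl_gen α hα (a - b)
  rw [← lintegral_sub_right_eq_self _ b] at this
  simp only [sub_sub_sub_cancel_right] at this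
  rw [this, ENNReal.toReal_ofReal (by positivity)]
  have := Real.pi_pos
  field_simp
  ring
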